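/- Assume g ≥ 2 and let i be an integer with 1 ≤ i ≤ g−1. Then F^{3i}(x_{3,1}^{2i}) = c·x_{0,2i} + α, where c ∈ ℚ is strictly negative and α lies in the ℚ-subalgebra of 𝒜 generated by y and the variables x_{0,2j} for 1 ≤ j ≤ i−1. -/

import Mathlib

open MvPolynomial

/-- The index set `S_g` of pairs `(i,j)` of integers. -/
def Sg (g : ℕ) : Set (ℤ × ℤ) :=
  {p | 0 ≤ p.1 ∧ 0 ≤ p.2 ∧ p.2 ≤ 2 * (g : ℤ) - 2 ∧ p.1 ≤ p.2 + 2 ∧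
    Even (p.1 + p.2) ∧ p ≠ (0, 0)}

/-- The variables of the polynomial algebra `𝒜`: one variable `x_{i,j}` for each
`(i,j) ∈ S_g`, plus one extra variable `y`. -/
abbrev JacVar (g : ℕ) := {p : ℤ × ℤ // p ∈ Sg g} ⊕ Unit

/-- The polynomial algebra `𝒜` over `ℚ`. -/
abbrev JacA (g : ℕ) := MvPolynomial (JacVar g) ℚ

open Classical in
/-- The element `x_{i,j}` of `𝒜`, with the conventions `x_{0,0} = g` and `x_{i,j} = 0` for
`(i,j) ∉ S_g ∪ {(0,0)}`. -/
noncomputable def Xv (g : ℕ) (i j : ℤ) : JacA g :=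
  if h : (i, j) ∈ Sg g then X (Sum.inl ⟨(i, j), h⟩)
  else if (i, j) = ((0 : ℤ), (0 : ℤ)) then C (g : ℚ) else 0

/-- The element `y` of `𝒜`. -/
noncomputable def Yv (g : ℕ) : JacA g := X (Sum.inr ())

/-- The bigrading: `x_{i,j}` has bidegree `(i,j)` and `y` has bidegree `(0,2)`. -/
def wt (g : ℕ) : JacVar g → ℤ × ℤ
  | Sum.inl p => p.1
  | Sum.inr _ => (0, 2)

/-- The bihomogeneous component `𝒜_{(i,j)}`. -/
noncomputable def Acomp (g : ℕ) (i j : ℤ) : Submodule ℚ (JacA g) :=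
  weightedHomogeneousSubmodule ℚ (wt g) (i, j)

/-- Binomial coefficient `binom(n,r)` for integers, equal to `0` unless `0 ≤ r ≤ n`. -/
def ibinom (n r : ℤ) : ℚ :=
  if 0 ≤ r ∧ r ≤ n then (n.toNat.choose r.toNat : ℚ) else 0

open Classical in
/-- The (finite) set `S_g` as a `Finset` of pairs of integers. -/
noncomputable def SgFinset (g : ℕ) : Finset (ℤ × ℤ) :=
  ((Finset.Icc (0 : ℤ) (2 * (g : ℤ))) ×ˢ (Finset.Icc (0 : ℤ) (2 * (g : ℤ)))).filter
    (· ∈ Sg g)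

open Classical in
/-- Partial derivative `∂x_{i,j}` (zero if `(i,j) ∉ S_g`). -/
noncomputable def pd (g : ℕ) (p : ℤ × ℤ) (P : JacA g) : JacA g :=
  if h : p ∈ Sg g then pderiv (Sum.inl ⟨p, h⟩) P else 0

/-- The operator `E`: multiplication by `x_{2,0}`. -/
noncomputable def Eop (g : ℕ) (P : JacA g) : JacA g := Xv g 2 0 * P

/-- The differential operator `F`. -/
noncomputable def Fop (g : ℕ) (P : JacA g) : JacA g :=
  (1 / 2 : ℚ) • (∑ p ∈ SgFinset g, ∑ q ∈ SgFinset g,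
      (Yv g * Xv g (p.1 - 1) (p.2 - 1) * Xv g (q.1 - 1) (q.2 - 1)
        - C (ibinom (p.1 + q.1 - 2) (p.1 - 1)) * Xv g (p.1 + q.1 - 2) (p.2 + q.2))
      * pd g p (pd g q P))
  + ∑ p ∈ SgFinset g, Xv g (p.1 - 2) p.2 * pd g p P

section JacobianOperator

variable {g : ℕ}

lemma mem_SgFinset {p : ℤ × ℤ} : p ∈ SgFinset g ↔ p ∈ Sg g := by
  simp only [SgFinset, Finset.mem_filter, Finset.mem_product, Finset.mem_Icc]
  refine ⟨fun h => h.2, fun h => ⟨?_, h⟩⟩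
  obtain ⟨h1, h2, h3, h4, -⟩ := h
  omega

lemma Xv_of_mem {i j : ℤ} (h : (i, j) ∈ Sg g) :
    Xv g i j = X (Sum.inl ⟨(i, j), h⟩) := by
  simp [Xv, h]

open Classical in
/-- The partial derivative `pd`, bundled as a derivation. -/
noncomputable def pdDer (g : ℕ) (p : ℤ × ℤ) : Derivation ℚ (JacA g) (JacA g) :=
  if h : p ∈ Sg g then pderiv (Sum.inl ⟨p, h⟩) else 0

lemma pd_eq_pdDer (p : ℤ × ℤ) (P : JacA g) : pd g p P = pdDer g p P := by
  unfold pd pdDer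
  split_ifs <;> simp

lemma pdDer_Yv (p : ℤ × ℤ) : pdDer g p (Yv g) = 0 := by
  classical
  unfold pdDer Yv
  split_ifs with h
  · exact pderiv_X_of_ne (by simp)
  · rfl

lemma pdDer_Xv_self {i j : ℤ} (h : (i, j) ∈ Sg g) : pdDer g (i, j) (Xv g i j) = 1 := by
  rw [Xv_of_mem h]
  simp [pdDer, h]

lemma pdDer_Xv_of_ne {p : ℤ × ℤ} {i j : ℤ} (h : p ≠ (i, j)) : pdDer g p (Xv g i j) = 0 := by
  classical
  unfold pdDer Xv
  split_ifs with h1 h2 h3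
  · exact pderiv_X_of_ne (by simpa using h.symm)
  · exact pderiv_C
  · simp
  all_goals rfl

lemma pdDer_Xv {i j : ℤ} (h : (i, j) ∈ Sg g) (p : ℤ × ℤ) :
    pdDer g p (Xv g i j) = if p = (i, j) then 1 else 0 := by
  split_ifs with hp
  · rw [hp, pdDer_Xv_self h]
  · exact pdDer_Xv_of_ne hp

/-- The coefficient of `∂_p ∂_q` in `2 F`. -/
noncomputable def secondCoeff (g : ℕ) (p q : ℤ × ℤ) : JacA g :=
  Yv g * Xv g (p.1 - 1) (p.2 - 1) * Xv g (q.1 - 1) (q.2 - 1)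
    - C (ibinom (p.1 + q.1 - 2) (p.1 - 1)) * Xv g (p.1 + q.1 - 2) (p.2 + q.2)

lemma Fop_eq (P : JacA g) : Fop g P =
    (1 / 2 : ℚ) • (∑ p ∈ SgFinset g, ∑ q ∈ SgFinset g,
      secondCoeff g p q * pdDer g p (pdDer g q P))
    + ∑ p ∈ SgFinset g, Xv g (p.1 - 2) p.2 * pdDer g p P := by
  simp only [Fop, secondCoeff, pd_eq_pdDer]

lemma Fop_add (P Q : JacA g) : Fop g (P + Q) = Fop g P + Fop g Q := by
  simp only [Fop_eq, map_add, mul_add, Finset.sum_add_distrib, smul_add]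
  abel

lemma Fop_smul (r : ℚ) (P : JacA g) : Fop g (r • P) = r • Fop g P := by
  simp only [Fop_eq, Derivation.map_smul, mul_smul_comm, ← Finset.smul_sum, smul_add]
  rw [smul_comm]

lemma Fop_sub (P Q : JacA g) : Fop g (P - Q) = Fop g P - Fop g Q := by
  have h := Fop_add P ((-1 : ℚ) • Q)
  rw [Fop_smul] at h
  simpa [sub_eq_add_neg] using h

/-- The failure of `F` to be a derivation. -/
noncomputable def bracket (g : ℕ) (P Q : JacA g) : JacA g :=
  (1 / 2 : ℚ) • ∑ p ∈ SgFinset g, ∑ q ∈ SgFinset g,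
    secondCoeff g p q * (pdDer g p P * pdDer g q Q + pdDer g q P * pdDer g p Q)

lemma Fop_mul (P Q : JacA g) :
    Fop g (P * Q) = Fop g P * Q + P * Fop g Q + bracket g P Q := by
  have h (p q : ℤ × ℤ) : secondCoeff g p q * pdDer g p (pdDer g q (P * Q)) =
      secondCoeff g p q * pdDer g p (pdDer g q P) * Q
      + P * (secondCoeff g p q * pdDer g p (pdDer g q Q))
      + secondCoeff g p q * (pdDer g p P * pdDer g q Q + pdDer g q P * pdDer g p Q) := by
    simp only [Derivation.leibniz, map_add, smul_eq_mul]
    ring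
  have h' (p : ℤ × ℤ) : Xv g (p.1 - 2) p.2 * pdDer g p (P * Q) =
      Xv g (p.1 - 2) p.2 * pdDer g p P * Q + P * (Xv g (p.1 - 2) p.2 * pdDer g p Q) := by
    simp only [Derivation.leibniz, smul_eq_mul]
    ring
  simp only [Fop_eq, bracket, h, h', Finset.sum_add_distrib, ← Finset.sum_mul, ← Finset.mul_sum,
    smul_add, add_mul, mul_add, smul_mul_assoc, mul_smul_comm]
  abel

lemma bracket_mul_right (P Q R : JacA g) :
    bracket g P (Q * R) = bracket g P Q * R + Q * bracket g P R := by
  simp only [bracket, smul_mul_assoc, mul_smul_comm, ← smul_add, Finset.sum_mul, Finset.mul_sum,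
    ← Finset.sum_add_distrib]
  congr 1
  refine Finset.sum_congr rfl fun p _ => Finset.sum_congr rfl fun q _ => ?_
  simp only [Derivation.leibniz, smul_eq_mul]
  ring

lemma bracket_Xv {i j k l : ℤ} (hp : (i, j) ∈ Sg g) (hq : (k, l) ∈ Sg g) :
    bracket g (Xv g i j) (Xv g k l) =
      (1 / 2 : ℚ) • (secondCoeff g (i, j) (k, l) + secondCoeff g (k, l) (i, j)) := by
  have hp' := mem_SgFinset.mpr hp
  have hq' := mem_SgFinset.mpr hq
  rw [bracket]
  congr 1
  simp only [pdDer_Xv hp, pdDer_Xv hq, mul_add, Finset.sum_add_distrib]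
  congr 1
  · rw [Finset.sum_eq_single_of_mem _ hp' (fun p _ h => by simp [h]),
      Finset.sum_eq_single_of_mem _ hq' (fun q _ h => by simp [h])]
    simp
  · rw [Finset.sum_eq_single_of_mem _ hq' (fun p _ h => by simp [h]),
      Finset.sum_eq_single_of_mem _ hp' (fun q _ h => by simp [h])]
    simp

lemma Fop_Yv_mul (Q : JacA g) : Fop g (Yv g * Q) = Yv g * Fop g Q := by
  have h1 : Fop g (Yv g) = 0 := by simp [Fop_eq, pdDer_Yv]
  have h2 : bracket g (Yv g) Q = 0 := by simp [bracket, pdDer_Yv]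
  rw [Fop_mul, h1, h2]
  ring

lemma Fop_C (r : ℚ) : Fop g (C r) = 0 := by
  have h (p : ℤ × ℤ) : pdDer g p (C r) = 0 := (pdDer g p).map_algebraMap r
  simp [Fop_eq, h]

lemma Fop_Xv {i j : ℤ} (h : (i, j) ∈ Sg g) : Fop g (Xv g i j) = Xv g (i - 2) j := by
  have h2 (p q : ℤ × ℤ) : pdDer g p (pdDer g q (Xv g i j)) = 0 := by
    rw [pdDer_Xv h]
    split_ifs <;> simp
  rw [Fop_eq]
  simp only [h2, mul_zero, Finset.sum_const_zero, smul_zero, zero_add]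
  simp [pdDer_Xv h, mem_SgFinset, h]

lemma Fop_Xv_of_notMem {i j : ℤ} (h : (i, j) ∉ Sg g) : Fop g (Xv g i j) = 0 := by
  unfold Xv
  rw [dif_neg h]
  split_ifs
  · exact Fop_C _
  · simpa using Fop_C (g := g) 0

/-- The generators of the sign cone. -/
def coneGens (g : ℕ) : Set (JacA g) :=
  {P | (∃ r : ℚ, 0 ≤ r ∧ P = C r) ∨ (∃ i j : ℤ, 1 ≤ j ∧ P = -Xv g i j) ∨ ∃ Q, P = Yv g * Q}

/-- The cone generated, modulo `y`, by the products of the `-x_{i,j}` with `j ≥ 1`. -/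
noncomputable def signCone (g : ℕ) : Subsemiring (JacA g) := Subsemiring.closure (coneGens g)

lemma C_mem_signCone {r : ℚ} (hr : 0 ≤ r) : C r ∈ signCone g :=
  Subsemiring.subset_closure (Or.inl ⟨r, hr, rfl⟩)

lemma neg_Xv_mem_signCone (i : ℤ) {j : ℤ} (hj : 1 ≤ j) : -Xv g i j ∈ signCone g :=
  Subsemiring.subset_closure (Or.inr (Or.inl ⟨i, j, hj, rfl⟩))

lemma Yv_mul_mem_signCone (Q : JacA g) : Yv g * Q ∈ signCone g :=
  Subsemiring.subset_closure (Or.inr (Or.inr ⟨Q, rfl⟩))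

lemma smul_mem_signCone {r : ℚ} (hr : 0 ≤ r) {P : JacA g} (hP : P ∈ signCone g) :
    r • P ∈ signCone g := by
  rw [smul_eq_C_mul]
  exact mul_mem (C_mem_signCone hr) hP

lemma neg_pdDer_mem_signCone (p : ℤ × ℤ) {P : JacA g} (hP : P ∈ signCone g) :
    -pdDer g p P ∈ signCone g := by
  induction hP using Subsemiring.closure_induction with
  | mem P hP =>
    obtain ⟨r, -, rfl⟩ | ⟨i, j, -, rfl⟩ | ⟨Q, rfl⟩ := hP
    · rw [show pdDer g p (C r) = 0 from (pdDer g p).map_algebraMap r, neg_zero]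
      exact zero_mem _
    · rw [map_neg, neg_neg]
      by_cases hp : p = (i, j)
      · by_cases h : (i, j) ∈ Sg g
        · rw [pdDer_Xv h, if_pos hp]
          exact one_mem _
        · subst hp
          rw [pdDer, dif_neg h]
          exact zero_mem _
      · rw [pdDer_Xv_of_ne hp]
        exact zero_mem _
    · rw [Derivation.leibniz, pdDer_Yv, smul_zero, add_zero, smul_eq_mul, ← mul_neg]
      exact Yv_mul_mem_signCone _
  | zero => simp
  | one => simp
  | add P Q _ _ hP hQ =>
    rw [map_add, neg_add]
    exact add_mem hP hQ
  | mul P Q hP' hQ' hP hQ =>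
    rw [Derivation.leibniz, neg_add, smul_eq_mul, smul_eq_mul, ← mul_neg, ← mul_neg]
    exact add_mem (mul_mem hP' hQ) (mul_mem hQ' hP)

lemma Yv_dvd_pdDer {p : ℤ × ℤ} (hp : p.2 ≤ 0) {P : JacA g} (hP : P ∈ signCone g) :
    Yv g ∣ pdDer g p P := by
  induction hP using Subsemiring.closure_induction with
  | mem P hP =>
    obtain ⟨r, -, rfl⟩ | ⟨i, j, hj, rfl⟩ | ⟨Q, rfl⟩ := hP
    · rw [show pdDer g p (C r) = 0 from (pdDer g p).map_algebraMap r]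
      exact dvd_zero _
    · rw [map_neg, pdDer_Xv_of_ne, neg_zero]
      · exact dvd_zero _
      · rintro rfl
        simp at hp
        omega
    · rw [Derivation.leibniz, pdDer_Yv, smul_zero, add_zero, smul_eq_mul]
      exact dvd_mul_right _ _
  | zero => simp
  | one => simp
  | add P Q _ _ hP hQ =>
    rw [map_add]
    exact dvd_add hP hQ
  | mul P Q hP' hQ' hP hQ =>
    rw [Derivation.leibniz]
    exact dvd_add (hQ.mul_left _) (hP.mul_left _)

lemma ibinom_nonneg (n r : ℤ) : 0 ≤ ibinom n r := by
  unfold ibinom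
  split_ifs <;> positivity

lemma ibinom_pos {n r : ℤ} (h0 : 0 ≤ r) (h : r ≤ n) : 0 < ibinom n r := by
  rw [ibinom, if_pos ⟨h0, h⟩]
  exact_mod_cast Nat.choose_pos (Int.toNat_le_toNat h)

lemma secondCoeff_mem_signCone {p q : ℤ × ℤ} (h : 1 ≤ p.2 + q.2) :
    secondCoeff g p q ∈ signCone g := by
  rw [secondCoeff, sub_eq_add_neg, ← mul_neg, mul_assoc]
  exact add_mem (Yv_mul_mem_signCone _)
    (mul_mem (C_mem_signCone (ibinom_nonneg _ _)) (neg_Xv_mem_signCone _ h))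

lemma secondCoeff_mul_mem_signCone (p q : ℤ × ℤ) {P Q : JacA g}
    (hP : P ∈ signCone g) (hQ : Q ∈ signCone g) (hq : 0 ≤ q.2) :
    secondCoeff g p q * (pdDer g p P * pdDer g q Q) ∈ signCone g := by
  by_cases h : 1 ≤ p.2 + q.2
  · rw [← neg_mul_neg (pdDer g p P)]
    exact mul_mem (secondCoeff_mem_signCone h)
      (mul_mem (neg_pdDer_mem_signCone p hP) (neg_pdDer_mem_signCone q hQ))
  · obtain ⟨R, hR⟩ := Yv_dvd_pdDer (p := p) (by omega) hP
    rw [hR, show secondCoeff g p q * (Yv g * R * pdDer g q Q) =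
      Yv g * (secondCoeff g p q * (R * pdDer g q Q)) by ring]
    exact Yv_mul_mem_signCone _

lemma bracket_mem_signCone {P Q : JacA g} (hP : P ∈ signCone g) (hQ : Q ∈ signCone g) :
    bracket g P Q ∈ signCone g := by
  refine smul_mem_signCone (by norm_num) (sum_mem fun p _ => sum_mem fun q hq => ?_)
  have hq2 := (mem_SgFinset.mp hq).2.1
  rw [mul_add, mul_comm (pdDer g q P)]
  exact add_mem (secondCoeff_mul_mem_signCone p q hP hQ hq2)
    (secondCoeff_mul_mem_signCone p q hQ hP hq2)

lemma Fop_mem_signCone {P : JacA g} (hP : P ∈ signCone g) : Fop g P ∈ signCone g := by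
  induction hP using Subsemiring.closure_induction with
  | mem P hP =>
    obtain ⟨r, -, rfl⟩ | ⟨i, j, hj, rfl⟩ | ⟨Q, rfl⟩ := hP
    · rw [Fop_C]
      exact zero_mem _
    · rw [← neg_one_smul ℚ, Fop_smul, neg_one_smul]
      by_cases h : (i, j) ∈ Sg g
      · rw [Fop_Xv h]
        exact neg_Xv_mem_signCone _ hj
      · rw [Fop_Xv_of_notMem h, neg_zero]
        exact zero_mem _
    · rw [Fop_Yv_mul]
      exact Yv_mul_mem_signCone _
  | zero =>
    rw [← C_0, Fop_C]
    exact zero_mem _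
  | one =>
    rw [← C_1, Fop_C]
    exact zero_mem _
  | add P Q _ _ hP hQ =>
    rw [Fop_add]
    exact add_mem hP hQ
  | mul P Q hP' hQ' hP hQ =>
    rw [Fop_mul]
    exact add_mem (add_mem (mul_mem hP hQ') (mul_mem hP' hQ)) (bracket_mem_signCone hP' hQ')

lemma Fop_step {P Q R : JacA g} {r : ℚ} (hr : 0 < r) (hP : P - r • Q ∈ signCone g)
    (hQ : ∃ s : ℚ, 0 < s ∧ Fop g Q - s • R ∈ signCone g) :
    ∃ s : ℚ, 0 < s ∧ Fop g P - s • R ∈ signCone g := by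
  obtain ⟨s, hs, h⟩ := hQ
  refine ⟨r * s, mul_pos hr hs, ?_⟩
  have h1 := add_mem (Fop_mem_signCone hP) (smul_mem_signCone hr.le h)
  rwa [Fop_sub, Fop_smul, smul_sub, sub_add_sub_cancel, smul_smul] at h1

lemma Fop_merge (a : ℕ) {i j k l : ℤ} (hp : (i, j) ∈ Sg g) (hq : (k, l) ∈ Sg g)
    (hi : 1 ≤ i) (hk : 1 ≤ k) (hj : 1 ≤ j) (hl : 1 ≤ l) :
    ∃ r : ℚ, 0 < r ∧ Fop g ((-Xv g i j) ^ (a + 1) * -Xv g k l) -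
      r • ((-Xv g i j) ^ a * -Xv g (i + k - 2) (j + l)) ∈ signCone g := by
  have hx := neg_Xv_mem_signCone (g := g) i hj
  have hz := neg_Xv_mem_signCone (g := g) k hl
  have hxa := pow_mem hx a
  refine ⟨(1 / 2) * (ibinom (i + k - 2) (i - 1) + ibinom (k + i - 2) (k - 1)), ?_, ?_⟩
  · have := ibinom_pos (n := i + k - 2) (r := i - 1) (by omega) (by omega)
    have := ibinom_nonneg (k + i - 2) (k - 1)
    positivity
  have hb : bracket g (-Xv g i j) (-Xv g k l) =
      bracket g (Xv g i j) (Xv g k l) := by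
    simp [bracket]
  have key : Fop g ((-Xv g i j) ^ (a + 1) * -Xv g k l) -
      ((1 / 2 : ℚ) * (ibinom (i + k - 2) (i - 1) + ibinom (k + i - 2) (k - 1))) •
        ((-Xv g i j) ^ a * -Xv g (i + k - 2) (j + l)) =
      Fop g (-Xv g i j) * ((-Xv g i j) ^ a * -Xv g k l)
      + -Xv g i j * Fop g ((-Xv g i j) ^ a * -Xv g k l)
      + bracket g (-Xv g i j) ((-Xv g i j) ^ a) * -Xv g k l
      + Yv g * ((-Xv g i j) ^ a *
          (Xv g (i - 1) (j - 1) * Xv g (k - 1) (l - 1))) := by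
    rw [pow_succ', mul_assoc, Fop_mul, bracket_mul_right, hb, bracket_Xv hp hq]
    simp only [secondCoeff, smul_eq_C_mul, add_comm k i, add_comm l j, map_mul, map_add]
    have h2 : (C (1 / 2) : JacA g) * 2 = 1 := by
      rw [← map_ofNat C 2, ← C_mul]
      norm_num
    linear_combination (Yv g * ((-Xv g i j) ^ a *
          (Xv g (i - 1) (j - 1) * Xv g (k - 1) (l - 1)))) * h2
  rw [key]
  exact add_mem (add_mem (add_mem (mul_mem (Fop_mem_signCone hx) (mul_mem hxa hz))
    (mul_mem hx (Fop_mem_signCone (mul_mem hxa hz))))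
    (mul_mem (bracket_mem_signCone hx hxa) hz)) (Yv_mul_mem_signCone _)

lemma iterate_Fop_merge (n a : ℕ) (hn : (n : ℤ) + 1 ≤ 2 * (g : ℤ) - 2) :
    ∃ r : ℚ, 0 < r ∧ (Fop g)^[n] ((-Xv g 3 1) ^ (n + a + 1)) -
      r • ((-Xv g 3 1) ^ a * -Xv g (n + 3) (n + 1)) ∈ signCone g := by
  induction n generalizing a with
  | zero =>
    refine ⟨1, one_pos, ?_⟩
    simp [pow_succ]
  | succ n ih =>
    push_cast at hn
    obtain ⟨r, hr, h⟩ := ih (a + 1) (by omega)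
    have hp : ((3 : ℤ), (1 : ℤ)) ∈ Sg g := by
      refine ⟨?_, ?_, ?_, ?_, ⟨2, ?_⟩, ?_⟩ <;> simp
      omega
    have hq : ((n : ℤ) + 3, (n : ℤ) + 1) ∈ Sg g := by
      refine ⟨?_, ?_, ?_, ?_, ⟨n + 2, ?_⟩, ?_⟩ <;> simp <;> omega
    have h' := Fop_step hr h
      (Fop_merge a hp hq (by omega) (by omega) (by omega) (by omega))
    rw [Function.iterate_succ_apply']
    convert h' using 9 <;> omega

lemma iterate_Fop_lower (m : ℕ) {k l : ℤ} (hk : 2 * (m : ℤ) ≤ k)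
    (h : (k, l) ∈ Sg g) :
    (Fop g)^[m] (-Xv g k l) = -Xv g (k - 2 * m) l := by
  induction m with
  | zero => simp
  | succ m ih =>
    push_cast at hk
    have h' : (k - 2 * (m : ℤ), l) ∈ Sg g := by
      obtain ⟨-, h2, h3, h4, ⟨t, h5⟩, -⟩ := h
      simp only at h2 h3 h4 h5
      refine ⟨?_, ?_, ?_, ?_, ⟨t - m, ?_⟩, ?_⟩ <;> simp <;> omega
    rw [Function.iterate_succ_apply', ih (by omega), ← neg_one_smul ℚ, Fop_smul, Fop_Xv h',
      neg_one_smul]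
    push_cast
    congr 2
    ring

lemma iterate_Fop_sub_smul_mem {m : ℕ} {P Q : JacA g} {r : ℚ}
    (h : P - r • Q ∈ signCone g) :
    (Fop g)^[m] P - r • (Fop g)^[m] Q ∈ signCone g := by
  induction m with
  | zero => simpa
  | succ m ih =>
    simp only [Function.iterate_succ_apply']
    rw [← Fop_smul, ← Fop_sub]
    exact Fop_mem_signCone ih

lemma iterate_Fop_pow_sub_mem_signCone {i : ℕ} (h1 : 1 ≤ i) (h2 : (i : ℤ) ≤ (g : ℤ) - 1) :
    ∃ r : ℚ, 0 < r ∧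
      (Fop g)^[3 * i] (Xv g 3 1 ^ (2 * i)) - r • -Xv g 0 (2 * (i : ℤ)) ∈ signCone g := by
  obtain ⟨n, rfl⟩ : ∃ n, i = n + 1 := ⟨i - 1, by omega⟩
  push_cast at h2 ⊢
  obtain ⟨r, hr, h⟩ := iterate_Fop_merge (g := g) (2 * n + 1) 0 (by push_cast; omega)
  refine ⟨r, hr, ?_⟩
  rw [pow_zero, one_mul] at h
  have h' := iterate_Fop_sub_smul_mem (m := n + 2) h
  rw [iterate_Fop_lower (n + 2) (by push_cast; omega)
    (by refine ⟨?_, ?_, ?_, ?_, ⟨2 * n + 3, ?_⟩, ?_⟩ <;> simp <;> omega),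
    ← Function.iterate_add_apply] at h'
  have e1 : n + 2 + (2 * n + 1) = 3 * (n + 1) := by ring
  have e2 : 2 * n + 1 + 0 + 1 = 2 * (n + 1) := by ring
  rw [e1, e2, (even_two_mul (n + 1)).neg_pow] at h'
  convert h' using 5 <;> push_cast <;> ring

/-- The substitution `y ↦ 0`, `x_{i,j} ↦ -x_{i,j}`. -/
noncomputable def negHom (g : ℕ) : JacA g →ₐ[ℚ] JacA g :=
  aeval (Sum.elim (fun p => -X (Sum.inl p)) fun _ => 0)

lemma coeff_negHom_nonneg {P : JacA g} (hP : P ∈ signCone g) (m : JacVar g →₀ ℕ) :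
    0 ≤ coeff m (negHom g P) := by
  classical
  induction hP using Subsemiring.closure_induction generalizing m with
  | mem P hP =>
    obtain ⟨r, hr, rfl⟩ | ⟨i, j, hj, rfl⟩ | ⟨Q, rfl⟩ := hP
    · rw [negHom, aeval_C, algebraMap_eq, coeff_C]
      split_ifs <;> simp [hr]
    · unfold Xv
      split_ifs with h h'
      · simp only [negHom, map_neg, aeval_X, Sum.elim_inl, neg_neg, coeff_X]
        split_ifs <;> simp
      · simp at h'
        omega
      · simp
    · simp [negHom, Yv]
  | zero => simp
  | one =>
    rw [map_one, coeff_one]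
    split_ifs <;> simp
  | add P Q _ _ hP hQ =>
    rw [map_add, coeff_add]
    exact add_nonneg (hP m) (hQ m)
  | mul P Q _ _ hP hQ =>
    rw [map_mul, coeff_mul]
    exact Finset.sum_nonneg fun x _ => mul_nonneg (hP _) (hQ _)

lemma coeff_single_negHom (P : JacA g) (p : {p : ℤ × ℤ // p ∈ Sg g}) :
    coeff (Finsupp.single (Sum.inl p) 1) (negHom g P) =
      -coeff (Finsupp.single (Sum.inl p) 1) P := by
  classical
  have h0 (P : JacA g) : coeff 0 (negHom g P) = coeff 0 P := by
    simp only [← constantCoeff_eq]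
    induction P using MvPolynomial.induction_on with
    | C a => simp [negHom]
    | add P Q hP hQ => simp only [map_add, hP, hQ]
    | mul_X P v hP => cases v <;> simp [negHom]
  have hm (P Q : JacA g) (v : JacVar g) : coeff (Finsupp.single v 1) (P * Q) =
      coeff 0 P * coeff (Finsupp.single v 1) Q + coeff (Finsupp.single v 1) P * coeff 0 Q := by
    rw [coeff_mul, Finsupp.antidiagonal_single]
    simp [Finset.Nat.antidiagonal_succ]
  induction P using MvPolynomial.induction_on with
  | C a =>
    have : (0 : JacVar g →₀ ℕ) ≠ Finsupp.single (Sum.inl p) 1 :=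
      (Finsupp.single_ne_zero.mpr one_ne_zero).symm
    simp [negHom, coeff_C, this]
  | add P Q hP hQ =>
    simp only [map_add, coeff_add, hP, hQ]
    ring
  | mul_X P v hP =>
    rw [map_mul, hm, hm, h0, h0, hP]
    have : coeff (Finsupp.single (Sum.inl p) 1) (negHom g (X v)) =
        -coeff (Finsupp.single (Sum.inl p) 1) (X v : JacA g) := by
      cases v <;> simp [negHom]
    rw [this]
    ring

lemma isWeightedHomogeneous_Xv (i j : ℤ) : IsWeightedHomogeneous (wt g) (Xv g i j) (i, j) := by
  unfold Xv
  split_ifs with h h'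
  · exact isWeightedHomogeneous_X ℚ (wt g) (Sum.inl ⟨(i, j), h⟩)
  · rw [h']
    exact isWeightedHomogeneous_C (wt g) _
  · exact isWeightedHomogeneous_zero _ _ _

lemma isWeightedHomogeneous_Yv : IsWeightedHomogeneous (wt g) (Yv g) (0, 2) :=
  isWeightedHomogeneous_X ℚ (wt g) (Sum.inr ())

lemma isWeightedHomogeneous_pdDer {P : JacA g} {d : ℤ × ℤ}
    (h : IsWeightedHomogeneous (wt g) P d) (p : ℤ × ℤ) :
    IsWeightedHomogeneous (wt g) (pdDer g p P) (d - p) := by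
  unfold pdDer
  split_ifs with hp
  · exact h.pderiv (sub_add_cancel d p)
  · exact isWeightedHomogeneous_zero _ _ _

lemma isWeightedHomogeneous_secondCoeff (p q : ℤ × ℤ) :
    IsWeightedHomogeneous (wt g) (secondCoeff g p q) (p + q - (2, 0)) := by
  refine IsWeightedHomogeneous.sub ?_ ?_
  · have e : p + q - (2, 0) = (0, 2) + (p.1 - 1, p.2 - 1) + (q.1 - 1, q.2 - 1) := by
      ext <;> simp <;> ring
    rw [e]
    exact (isWeightedHomogeneous_Yv.mul (isWeightedHomogeneous_Xv _ _)).mul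
      (isWeightedHomogeneous_Xv _ _)
  · have e : p + q - (2, 0) = (p.1 + q.1 - 2, p.2 + q.2) := by ext <;> simp
    rw [e]
    exact (isWeightedHomogeneous_Xv _ _).C_mul _

lemma isWeightedHomogeneous_Fop {P : JacA g} {d : ℤ × ℤ}
    (h : IsWeightedHomogeneous (wt g) P d) :
    IsWeightedHomogeneous (wt g) (Fop g P) (d - (2, 0)) := by
  rw [Fop_eq, smul_eq_C_mul]
  refine IsWeightedHomogeneous.add (IsWeightedHomogeneous.C_mul ?_ _) ?_
  · refine IsWeightedHomogeneous.sum _ _ _ fun p _ => IsWeightedHomogeneous.sum _ _ _ fun q _ => ?_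
    convert (isWeightedHomogeneous_secondCoeff p q).mul
      (isWeightedHomogeneous_pdDer (isWeightedHomogeneous_pdDer h q) p) using 1
    abel
  · refine IsWeightedHomogeneous.sum _ _ _ fun p _ => ?_
    convert (isWeightedHomogeneous_Xv (p.1 - 2) p.2).mul (isWeightedHomogeneous_pdDer h p) using 1
    ext <;> simp

lemma isWeightedHomogeneous_iterate_Fop {P : JacA g} {d : ℤ × ℤ}
    (h : IsWeightedHomogeneous (wt g) P d) (n : ℕ) :
    IsWeightedHomogeneous (wt g) ((Fop g)^[n] P) (d - n • (2, 0)) := by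
  induction n with
  | zero => simpa
  | succ n ih =>
    rw [Function.iterate_succ_apply']
    convert isWeightedHomogeneous_Fop ih using 1
    rw [succ_nsmul]
    abel

lemma wt_nonneg (v : JacVar g) : 0 ≤ wt g v := by
  obtain p | _ := v
  · exact ⟨p.2.1, p.2.2.1⟩
  · exact ⟨le_rfl, zero_le_two⟩

lemma wt_ne_zero (v : JacVar g) : wt g v ≠ 0 := by
  obtain p | _ := v
  · exact p.2.2.2.2.2.2
  · simp [wt]

lemma weight_wt_nonneg (m : JacVar g →₀ ℕ) : 0 ≤ Finsupp.weight (wt g) m := by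
  rw [Finsupp.weight_apply]
  exact Finset.sum_nonneg fun v _ => nsmul_nonneg (wt_nonneg v) _

lemma wt_le_weight {m : JacVar g →₀ ℕ} {v : JacVar g} (hv : m v ≠ 0) :
    wt g v ≤ Finsupp.weight (wt g) m := by
  rw [← Finsupp.weight_sub_single_add (w := wt g) hv]
  exact le_add_of_nonneg_left (weight_wt_nonneg _)

lemma eq_single_of_weight_eq {m : JacVar g →₀ ℕ} {v : JacVar g} (hv : m v ≠ 0)
    (h : Finsupp.weight (wt g) m = wt g v) : m = Finsupp.single v 1 := by
  have h1 := Finsupp.weight_sub_single_add (w := wt g) hv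
  rw [h, add_eq_right] at h1
  have h2 : m - Finsupp.single v 1 = 0 := by
    by_contra hne
    obtain ⟨u, hu⟩ := Finsupp.ne_iff.mp hne
    exact wt_ne_zero u (le_antisymm (h1 ▸ wt_le_weight hu) (wt_nonneg u))
  rw [← tsub_add_cancel_of_le (Finsupp.single_le_iff.mpr (Nat.one_le_iff_ne_zero.mpr hv)), h2,
    zero_add]

lemma sub_coeff_smul_Xv_mem_adjoin {i : ℕ} {P : JacA g} (hx : ((0 : ℤ), 2 * (i : ℤ)) ∈ Sg g)
    (hP : IsWeightedHomogeneous (wt g) P (0, 2 * (i : ℤ))) :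
    P - coeff (Finsupp.single (Sum.inl ⟨_, hx⟩) 1) P • Xv g 0 (2 * (i : ℤ)) ∈
      Algebra.adjoin ℚ
        ({Yv g} ∪ {P | ∃ j : ℕ, 1 ≤ j ∧ (j : ℤ) ≤ (i : ℤ) - 1 ∧ P = Xv g 0 (2 * (j : ℤ))}) := by
  classical
  set c := coeff (Finsupp.single (Sum.inl ⟨_, hx⟩) 1) P with hc
  set α := P - c • Xv g 0 (2 * (i : ℤ)) with hα
  have hαw : IsWeightedHomogeneous (wt g) α (0, 2 * (i : ℤ)) := by
    rw [hα, smul_eq_C_mul]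
    exact hP.sub ((isWeightedHomogeneous_Xv _ _).C_mul _)
  have hα0 : coeff (Finsupp.single (Sum.inl ⟨_, hx⟩) 1) α = 0 := by
    rw [hα, Xv_of_mem hx]
    simp [hc]
  set s : Set (JacVar g) := {v | (X v : JacA g) ∈ ({Yv g} ∪
    {P | ∃ j : ℕ, 1 ≤ j ∧ (j : ℤ) ≤ (i : ℤ) - 1 ∧ P = Xv g 0 (2 * (j : ℤ))} : Set (JacA g))}
  have hs : α ∈ supported ℚ s := by
    rw [mem_supported]
    intro v hv
    obtain ⟨m, hm, hvm⟩ := (mem_vars_iff_mem_support v).mp (Finset.mem_coe.mp hv)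
    rw [Finsupp.mem_support_iff] at hvm
    have hmw := hαw (mem_support_iff.mp hm)
    have hle := wt_le_weight hvm
    rw [hmw] at hle
    obtain ⟨⟨a, b⟩, hab⟩ | _ := v
    · obtain ⟨ha, hb⟩ := hle
      simp only [wt] at ha hb
      obtain ⟨ha0, hb0, -, -, ⟨t, ht⟩, hne⟩ := id hab
      simp only at ha0 hb0 ht
      obtain rfl : a = 0 := le_antisymm ha ha0
      have hb1 : b ≠ 0 := fun h => hne (by rw [h])
      have hb2 : b ≠ 2 * (i : ℤ) := by
        rintro rfl
        have := eq_single_of_weight_eq hvm (by rw [hmw]; rfl)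
        rw [this, mem_support_iff] at hm
        exact hm hα0
      refine Or.inr ⟨t.toNat, by omega, by omega, ?_⟩
      have : 2 * (t.toNat : ℤ) = b := by omega
      rw [this, Xv_of_mem hab]
    · exact Or.inl rfl
  rw [supported] at hs
  refine Algebra.adjoin_mono ?_ hs
  rintro _ ⟨v, hv, rfl⟩
  exact hv

end JacobianOperator

/-- For `g ≥ 2` and `1 ≤ i ≤ g−1`, `F^{3i}(x_{3,1}^{2i}) = c·x_{0,2i} + α`
with `c < 0` and `α` in the `ℚ`-subalgebra generated by `y` and the `x_{0,2j}`,
`1 ≤ j ≤ i−1`. -/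
theorem statement_7 (g : ℕ) (hg : 2 ≤ g) (i : ℕ) (h1 : 1 ≤ i)
    (h2 : (i : ℤ) ≤ (g : ℤ) - 1) :
    ∃ (c : ℚ) (α : JacA g), c < 0 ∧
      α ∈ Algebra.adjoin ℚ
        ({Yv g} ∪ {P | ∃ j : ℕ, 1 ≤ j ∧ (j : ℤ) ≤ (i : ℤ) - 1 ∧ P = Xv g 0 (2 * (j : ℤ))}) ∧
      (Fop g)^[3 * i] ((Xv g 3 1) ^ (2 * i)) = c • Xv g 0 (2 * (i : ℤ)) + α := by
  have hx : ((0 : ℤ), 2 * (i : ℤ)) ∈ Sg g := by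
    refine ⟨?_, ?_, ?_, ?_, ⟨i, ?_⟩, ?_⟩ <;> simp <;> omega
  have hw : IsWeightedHomogeneous (wt g) ((Fop g)^[3 * i] (Xv g 3 1 ^ (2 * i)))
      (0, 2 * (i : ℤ)) := by
    convert isWeightedHomogeneous_iterate_Fop
      ((isWeightedHomogeneous_Xv (g := g) 3 1).pow (2 * i)) (3 * i) using 1
    ext <;> simp
    ring
  refine ⟨coeff (Finsupp.single (Sum.inl ⟨_, hx⟩) 1) ((Fop g)^[3 * i] (Xv g 3 1 ^ (2 * i))), _, ?_,
    sub_coeff_smul_Xv_mem_adjoin hx hw, (add_sub_cancel _ _).symm⟩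
  obtain ⟨r, hr, h⟩ := iterate_Fop_pow_sub_mem_signCone h1 h2
  have h' := coeff_negHom_nonneg h (Finsupp.single (Sum.inl ⟨_, hx⟩) 1)
  rw [coeff_single_negHom, Xv_of_mem hx, coeff_sub, coeff_smul, coeff_neg, coeff_X] at h'
  simp only [smul_eq_mul, if_true] at h'
  linarith
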